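/- arXiv:1903.00451 — 2 statements merged into one kernel-verified Lean document; each statement's English description precedes it below -/
import Mathlib

section
/- Let 𝒜 be a unital prime ∗-algebra over ℂ with a nontrivial projection, and let Φ: 𝒜 → 𝒜 be a map satisfying Φ(A ⋄ B ⋄ C) = Φ(A) ⋄ B ⋄ C + A ⋄ Φ(B) ⋄ C + A ⋄ B ⋄ Φ(C) for all A, B, C ∈ 𝒜, such that Φ(1) is self-adjoint. Then Φ preserves the involution: Φ(A*) = Φ(A)* for all A ∈ 𝒜. -/
/-- The ∗-Jordan product `A ⋄ B = AB + BA*`. -/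
def sJordan {A : Type*} [Ring A] [StarRing A] (x y : A) : A :=
  x * y + y * star x

/-- The triple product `A ⋄ B ⋄ C = (A ⋄ B) ⋄ C`. -/
def sJordanTriple {A : Type*} [Ring A] [StarRing A] (x y z : A) : A :=
  sJordan (sJordan x y) z


section helpers
variable {A : Type*} [Ring A] [Algebra ℂ A] [StarRing A] [StarModule ℂ A]

theorem aux_two (x : A) (h : x + x = 0) : x = 0 := by
  have h2 : (2 : ℂ) • x = 0 := by rw [two_smul]; exact h
  have : x = (2⁻¹ : ℂ) • ((2 : ℂ) • x) := by rw [smul_smul]; norm_num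
  rw [this, h2, smul_zero]

theorem aux_I (x : A) (h : Complex.I • x = 0) : x = 0 := by
  have : x = (-Complex.I) • (Complex.I • x) := by rw [smul_smul]; simp
  rw [this, h, smul_zero]

theorem core1 (hprime : ∀ a b : A, (∀ x : A, a * x * b = 0) → a = 0 ∨ b = 0)
    (P : A) (sP : star P = P) (pp : P * P = P) (d : A → A)
    (hd : ∀ x c, d (x * c + c * star x) = x * d c + d c * star x)
    (hsa : ∀ x, star x = x → d x = 0) (hsk : ∀ x, star x = -x → d x = 0)
    (a : A) (h1 : P * a = a) (h2 : a * P = 0) : d a = 0 := by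
  have h1' : star a * P = star a := by rw [← sP, ← star_mul, h1]
  have h2' : P * star a = 0 := by rw [← sP, ← star_mul, h2, star_zero]
  have e1 := hd P a
  rw [sP, h1, h2, add_zero] at e1
  have e0 := hd (Complex.I • P) a
  have c0 : Complex.I • P * a + a * star (Complex.I • P) = Complex.I • a := by
    simp [star_smul, sP, h1, h2]
  rw [c0] at e0
  generalize hS : d a = S at *
  have e0' : d (Complex.I • a) = Complex.I • (P * S - S * P) := by
    rw [e0]; simp [star_smul, sP, smul_sub, sub_eq_add_neg]
  have pSp : P * S * P = 0 := by
    have := congrArg (fun t => P * t * P) e1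
    have e : P * (P * S + S * P) * P = P * S * P + P * S * P := by
      simp only [mul_add, add_mul, mul_assoc, pp]
      simp only [← mul_assoc, pp]
    simp only [e] at this
    simpa using this
  have key : ∀ y : A, P * y = 0 → y * P = 0 → star y = y →
      P * S * y * star a = 0 ∧ a * y * S * P = 0 := by
    intro y y1 y2 sy
    have aya : a * y * a = 0 := by rw [← h1, ← mul_assoc, mul_assoc _ y P, y2]; simp
    have f := hd (a * y) a
    have g := hd (a * y) (Complex.I • a)
    rw [aya, zero_add, hsa _ (by simp [sy, mul_assoc]), hS, star_mul, sy] at f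
    have aya' : a * y * Complex.I • a = 0 := by rw [mul_smul_comm, aya, smul_zero]
    rw [aya', zero_add, hsk _ (by simp [sy, mul_assoc, star_smul]), e0', star_mul, sy] at g
    have g' : 0 = a * y * (P * S - S * P) + (P * S - S * P) * (y * star a) := by
      refine (aux_I _ ?_).symm
      rw [smul_add, ← mul_smul_comm, ← smul_mul_assoc]; exact g.symm
    have g2 : a * y * S * P = P * S * y * star a := by
      have k1 : a * y * (P * S - S * P) = - (a * y * S * P) := by
        rw [mul_sub, ← mul_assoc, mul_assoc a y P, y2]; simp [mul_assoc]
      have k2 : (P * S - S * P) * (y * star a) = P * S * y * star a := by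
        rw [sub_mul, mul_assoc S P, ← mul_assoc P y, y1]; simp [mul_assoc]
      rw [k1, k2] at g'
      rw [← sub_eq_zero, ← neg_eq_zero, g']; abel
    have f2 : a * y * S * P + P * S * y * star a = 0 := by
      have := congrArg (fun t => P * t * P) f
      simp only [mul_zero, zero_mul, mul_add, add_mul, mul_assoc, h1'] at this
      rw [this]
      simp only [← mul_assoc, h1]
    have z : P * S * y * star a = 0 := aux_two _ (by rw [g2] at f2; exact f2)
    exact ⟨z, by rw [g2, z]⟩
  have key2 : ∀ y : A, P * y = 0 → y * P = 0 →
      P * S * y * star a = 0 ∧ a * y * S * P = 0 := by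
    intro y y1 y2
    have y1' : star y * P = 0 := by rw [← sP, ← star_mul, y1, star_zero]
    have y2' : P * star y = 0 := by rw [← sP, ← star_mul, y2, star_zero]
    have k1 := key (y + star y) (by simp [mul_add, y1, y2']) (by simp [add_mul, y2, y1'])
      (by simp [add_comm])
    have k2 := key (Complex.I • (y - star y)) (by simp [mul_sub, y1, y2'])
      (by simp [sub_mul, y2, y1']) (by simp [star_smul, smul_sub]; abel)
    obtain ⟨k1a, k1b⟩ := k1
    obtain ⟨k2a, k2b⟩ := k2
    have k2a' : P * S * (y - star y) * star a = 0 := aux_I _ (by simpa using k2a)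
    have k2b' : a * (y - star y) * S * P = 0 := aux_I _ (by simpa using k2b)
    constructor
    · apply aux_two
      rw [mul_add, add_mul] at k1a
      rw [mul_sub, sub_mul] at k2a'
      rw [sub_eq_zero] at k2a'
      nth_rw 2 [k2a']; exact k1a
    · apply aux_two
      rw [mul_add, add_mul, add_mul] at k1b
      rw [mul_sub, sub_mul, sub_mul] at k2b'
      rw [sub_eq_zero] at k2b'
      nth_rw 2 [k2b']; exact k1b
  have q1 : P * (1 - P) = 0 := by rw [mul_sub, pp, mul_one, sub_self]
  have q2 : (1 - P) * P = 0 := by rw [sub_mul, pp, one_mul, sub_self]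
  have key3 : ∀ x : A, P * S * (1 - P) * x * star a = 0 ∧ a * x * ((1 - P) * S * P) = 0 := by
    intro x
    obtain ⟨u, v⟩ := key2 ((1 - P) * x * (1 - P)) (by rw [← mul_assoc, ← mul_assoc, q1]; simp)
      (by rw [mul_assoc, q2]; simp)
    have qa : (1 - P) * star a = star a := by rw [sub_mul, h2', one_mul, sub_zero]
    have aq : a * (1 - P) = a := by rw [mul_sub, h2, mul_one, sub_zero]
    constructor
    · rw [← u]; simp only [mul_assoc, qa]
    · rw [← v]; simp only [← mul_assoc, aq]
  by_cases ha : a = 0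
  · rw [← hS]; exact hsa a (by rw [ha, star_zero])
  have r1 := (hprime _ _ (fun x => (key3 x).1)).resolve_right (by simpa using ha)
  have r2 := (hprime _ _ (fun x => (key3 x).2)).resolve_left ha
  rw [mul_sub, pSp, mul_one, sub_zero] at r1
  rw [sub_mul, sub_mul, pSp, one_mul, sub_zero] at r2
  rw [e1, r1, r2, add_zero]

theorem core2 (hprime : ∀ a b : A, (∀ x : A, a * x * b = 0) → a = 0 ∨ b = 0)
    (P : A) (sP : star P = P) (pp : P * P = P) (P1 : P ≠ 1) (d : A → A)
    (hd : ∀ x c, d (x * c + c * star x) = x * d c + d c * star x)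
    (hsa : ∀ x, star x = x → d x = 0) (hsk : ∀ x, star x = -x → d x = 0)
    (a : A) (h1 : P * a = a) (h2 : a * P = 0) : d (P + a) = 0 := by
  have q1 : P * (1 - P) = 0 := by rw [mul_sub, pp, mul_one, sub_self]
  have q2 : (1 - P) * P = 0 := by rw [sub_mul, pp, one_mul, sub_self]
  have e1 := hd (1 - P) (P + a)
  have c1 : (1 - P) * (P + a) + (P + a) * star (1 - P) = a := by
    simp [sP, sub_mul, mul_sub, add_mul, mul_add, pp, h1, h2]
  rw [c1, core1 hprime P sP pp d hd hsa hsk a h1 h2] at e1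
  have e2 : ∀ b : A, P * b = 0 → b * P = b → b * d (P + a) = 0 := by
    intro b b1 b2
    have b1' : star b * P = 0 := by rw [← sP, ← star_mul, b1, star_zero]
    have b2' : P * star b = star b := by rw [← sP, ← star_mul, b2]
    have f := hd P (b * (P + a) + (P + a) * star b)
    rw [hd b (P + a)] at f
    have ab : a * star b = 0 := by rw [← b2', ← mul_assoc, h2, zero_mul]
    have ba : b * a * P = 0 := by rw [mul_assoc, h2, mul_zero]
    have pba : P * (b * a) = 0 := by rw [← mul_assoc, b1, zero_mul]
    have c2 : P * (b * (P + a) + (P + a) * star b) + (b * (P + a) + (P + a) * star b) * star P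
        = star b + b := by
      simp [sP, add_mul, mul_add, b1, b2, b1', b2', ab, ba, pba]
    rw [c2, hsa _ (by simp [add_comm])] at f
    generalize d (P + a) = S at *
    have g := congrArg (fun t => (1 - P) * t * P) f
    have st : star (1 - P) = 1 - P := by simp [sP]
    rw [st] at e1
    have PS : S = P * S * P := by
      have k1 : (1 - P) * S * (1 - P) = - ((1 - P) * S) := by
        have := congrArg (fun t => (1 - P) * t) e1
        have qq : (1 - P) * (1 - P) = 1 - P := by rw [mul_sub, q2]; simp
        simp only [mul_zero, mul_add, ← mul_assoc, qq] at this
        rw [eq_neg_iff_add_eq_zero, this]; abel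
      have k2 : (1 - P) * S * (1 - P) = - (S * (1 - P)) := by
        have := congrArg (fun t => t * (1 - P)) e1
        have qq : (1 - P) * (1 - P) = 1 - P := by rw [mul_sub, q2]; simp
        simp only [zero_mul, add_mul, mul_assoc, qq] at this
        rw [eq_neg_iff_add_eq_zero, mul_assoc, this]
      have k3 : (1 - P) * S = S * (1 - P) := by rw [k1] at k2; exact neg_injective k2
      have k4 : (1 - P) * S = 0 := aux_two _ (by nth_rw 2 [k3]; exact e1.symm)
      have k5 : S * (1 - P) = 0 := by rw [← k3, k4]
      have k6 : S = P * S := by rw [sub_mul, one_mul, sub_eq_zero] at k4; exact k4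
      have k7 : S = S * P := by rw [mul_sub, mul_one, sub_eq_zero] at k5; exact k5
      rw [← k6, ← k7]
    have SP : S * P = S := by rw [PS, mul_assoc, pp]
    have PS' : P * S = S := by rw [PS, ← mul_assoc, ← mul_assoc, pp]
    rw [sP, mul_add, add_mul, ← mul_assoc P b, b1, ← mul_assoc P S, PS', mul_assoc b, SP,
      mul_assoc S, b1', zero_mul, mul_zero, zero_add, add_zero] at f
    have g := congrArg (fun t => t * P) f
    simp only [zero_mul, add_mul, mul_assoc, b1', SP, mul_zero, zero_add] at g
    exact g.symm
  have SP : P * d (P + a) = d (P + a) := by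
    have st : star (1 - P) = 1 - P := by simp [sP]
    rw [st] at e1
    generalize d (P + a) = S at *
    have qq : (1 - P) * (1 - P) = 1 - P := by rw [mul_sub, q2]; simp
    have k1 : (1 - P) * S * (1 - P) = - ((1 - P) * S) := by
      have := congrArg (fun t => (1 - P) * t) e1
      simp only [mul_zero, mul_add, ← mul_assoc, qq] at this
      rw [eq_neg_iff_add_eq_zero, this]; abel
    have k2 : (1 - P) * S * (1 - P) = - (S * (1 - P)) := by
      have := congrArg (fun t => t * (1 - P)) e1
      simp only [zero_mul, add_mul, mul_assoc, qq] at this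
      rw [eq_neg_iff_add_eq_zero, mul_assoc, this]
    have k3 : (1 - P) * S = S * (1 - P) := by rw [k1] at k2; exact neg_injective k2
    have k4 : (1 - P) * S = 0 := aux_two _ (by nth_rw 2 [k3]; exact e1.symm)
    rw [sub_mul, one_mul, sub_eq_zero] at k4; exact k4.symm
  refine (hprime (1 - P) _ fun x => ?_).resolve_left (fun h => P1 (sub_eq_zero.1 h).symm)
  have := e2 ((1 - P) * x * P) (by rw [← mul_assoc, ← mul_assoc, q1]; simp)
    (by rw [mul_assoc, pp])
  rw [mul_assoc _ P, SP] at this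
  exact this

theorem core3 (hprime : ∀ a b : A, (∀ x : A, a * x * b = 0) → a = 0 ∨ b = 0)
    (P : A) (sP : star P = P) (pp : P * P = P) (P1 : P ≠ 1) (d : A → A)
    (hd : ∀ x c, d (x * c + c * star x) = x * d c + d c * star x)
    (hsa : ∀ x, star x = x → d x = 0) (hsk : ∀ x, star x = -x → d x = 0)
    (a b : A) (h1 : P * a = a) (h2 : a * P = 0) (b1 : P * b = 0) (b2 : b * P = b) :
    d (a + b) = 0 := by
  have b1' : star b * P = 0 := by rw [← sP, ← star_mul, b1, star_zero]
  have b2' : P * star b = star b := by rw [← sP, ← star_mul, b2]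
  have k := core2 hprime P sP pp P1 d hd hsa hsk (a - star b) (by rw [mul_sub, h1, b2'])
    (by rw [sub_mul, h2, b1', sub_zero])
  have e := hd (1 - P + b) (P + (a - star b))
  rw [k, mul_zero, zero_mul, add_zero] at e
  have f := hd P ((1 - P + b) * (P + (a - star b)) + (P + (a - star b)) * star (1 - P + b))
  rw [e, mul_zero, zero_mul, add_zero] at f
  rw [← f]
  congr 1
  have ab : a * star b = 0 := by rw [← b2', ← mul_assoc, h2, zero_mul]
  have bb : star b * star b = 0 := by nth_rw 2 [← b2']; rw [← mul_assoc, b1', zero_mul]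
  have ba : b * a * P = 0 := by rw [mul_assoc, h2, mul_zero]
  have pba : P * (b * a) = 0 := by rw [← mul_assoc, b1, zero_mul]
  have bbp : b * star b * P = 0 := by rw [mul_assoc, b1', mul_zero]
  have pbb : P * (b * star b) = 0 := by rw [← mul_assoc, b1, zero_mul]
  simp [sP, add_mul, mul_add, sub_mul, mul_sub, pp, h1, h2, b1, b2, b1', b2', ab, bb, ba, pba,
    bbp, pbb]
  try abel

theorem core4 (hprime : ∀ a b : A, (∀ x : A, a * x * b = 0) → a = 0 ∨ b = 0)
    (P : A) (sP : star P = P) (pp : P * P = P) (P0 : P ≠ 0) (P1 : P ≠ 1) (d : A → A)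
    (hd : ∀ x c, d (x * c + c * star x) = x * d c + d c * star x)
    (hsa : ∀ x, star x = x → d x = 0) (hsk : ∀ x, star x = -x → d x = 0)
    (c : A) : d c = 0 := by
  have q1 : P * (1 - P) = 0 := by rw [mul_sub, pp, mul_one, sub_self]
  have q2 : (1 - P) * P = 0 := by rw [sub_mul, pp, one_mul, sub_self]
  have ppx : ∀ x, P * (P * x) = P * x := fun x => by rw [← mul_assoc, pp]
  have comm : ∀ c, P * d c = d c * P := by
    intro c
    have e := hd (Complex.I • P) c
    have k := core3 hprime P sP pp P1 d hd hsa hsk (Complex.I • (P * c - P * c * P))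
      (Complex.I • (P * c * P - c * P))
      (by simp [mul_sub, mul_assoc, ppx]) (by simp [sub_mul, mul_assoc, pp])
      (by simp [mul_sub, mul_assoc, ppx]) (by simp [sub_mul, mul_assoc, pp])
    rw [← smul_add] at k
    have c0 : Complex.I • P * c + c * star (Complex.I • P)
        = Complex.I • (P * c - P * c * P + (P * c * P - c * P)) := by
      rw [sub_add_sub_cancel]; simp [star_smul, sP, smul_sub, sub_eq_add_neg]
    rw [c0, k] at e
    have : P * d c - d c * P = 0 := by
      apply aux_I
      rw [e]; simp [star_smul, sP, smul_sub, sub_eq_add_neg]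
    exact sub_eq_zero.1 this
  have s1 : P * d c = 0 := by
    refine (hprime (1 - P) _ fun x => ?_).resolve_left (fun h => P1 (sub_eq_zero.1 h).symm)
    obtain ⟨b, hb⟩ : ∃ b, b = (1 - P) * x * P := ⟨_, rfl⟩
    have b1 : P * b = 0 := by rw [hb, ← mul_assoc, ← mul_assoc, q1]; simp
    have b1' : star b * P = 0 := by rw [← sP, ← star_mul, b1, star_zero]
    have k := comm (b * c + c * star b)
    rw [hd] at k
    have k2 := congrArg (fun t => t * P) k
    simp only [mul_add, add_mul, mul_assoc, b1', pp, mul_zero, add_zero] at k2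
    rw [← mul_assoc P b, b1, zero_mul, ← comm c, ← mul_assoc, hb, mul_assoc _ P P, pp] at k2
    rw [← mul_assoc, ← k2]
  have s2 : d c * P = 0 := by rw [← comm, s1]
  refine (hprime P _ fun x => ?_).resolve_left P0
  obtain ⟨b, hb⟩ : ∃ b, b = P * x * (1 - P) := ⟨_, rfl⟩
  have b1 : P * b = b := by rw [hb, ← mul_assoc, ← mul_assoc, pp]
  have k := comm (b * c + c * star b)
  rw [hd] at k
  have k2 := congrArg (fun t => P * t) k
  have bS : b * d c = P * x * d c := by
    rw [hb, mul_assoc, sub_mul, s1, one_mul, sub_zero]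
  have k3 : P * (d c * star b) = 0 := by rw [← mul_assoc, s1, zero_mul]
  simp only [mul_add, add_mul, ppx, k3, add_zero, mul_assoc b, s2, mul_zero, zero_add] at k2
  rw [← mul_assoc P b, b1, bS, ← mul_assoc P, k3.symm ▸ zero_mul P |> fun h => (by
    rw [← mul_assoc, s1, zero_mul, zero_mul] : P * (d c * star b) * P = 0)] at k2
  exact k2

end helpers

theorem stmt10 {A : Type*} [Ring A] [Algebra ℂ A] [StarRing A] [StarModule ℂ A]
    (hprime : ∀ a b : A, (∀ x : A, a * x * b = 0) → a = 0 ∨ b = 0)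
    (hproj : ∃ P : A, star P = P ∧ P * P = P ∧ P ≠ 0 ∧ P ≠ 1)
    (Φ : A → A)
    (hΦ : ∀ a b c : A, Φ (sJordanTriple a b c) =
      sJordanTriple (Φ a) b c + sJordanTriple a (Φ b) c + sJordanTriple a b (Φ c))
    (h1 : star (Φ 1) = Φ 1) :
    ∀ a : A, Φ (star a) = star (Φ a) := by
  obtain ⟨P, sP, pp, P0, P1⟩ := hproj
  have H : ∀ a b c : A, Φ ((a * b + b * star a) * c + c * star (a * b + b * star a)) =
      ((Φ a * b + b * star (Φ a)) * c + c * star (Φ a * b + b * star (Φ a))) +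
      ((a * Φ b + Φ b * star a) * c + c * star (a * Φ b + Φ b * star a)) +
      ((a * b + b * star a) * Φ c + Φ c * star (a * b + b * star a)) := hΦ
  have Φ0 : Φ 0 = 0 := by simpa using H 0 0 0
  have cen : ∀ z : A, star z = -z → (∀ x, z * x = x * z) → ∀ x, Φ z * x = x * Φ z := by
    intro z hz hc
    have z0 : ∀ b, z * b + b * star z = 0 := by intro b; rw [hz, hc]; simp
    have e : ∀ b c, (Φ z * b + b * star (Φ z)) * c + c * star (Φ z * b + b * star (Φ z)) = 0 := by
      intro b c
      have := H z b c
      rw [z0, z0] at this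
      simpa [Φ0] using this.symm
    have sk : star (Φ z) = - Φ z := by
      have := e 1 1
      simp only [mul_one, one_mul, star_add, star_star] at this
      rw [add_comm (star (Φ z))] at this
      have := aux_two _ this
      rw [eq_neg_iff_add_eq_zero, add_comm, this]
    intro x
    have e1 := e x 1
    have e2 := e (Complex.I • x) 1
    have k : Complex.I • ((Φ z * x - x * Φ z) - star (Φ z * x - x * Φ z)) = 0 := by
      rw [← e2]
      simp [sk, star_smul, smul_sub]
      abel
    have k := aux_I _ k
    rw [sk] at e1
    simp only [mul_one, one_mul, mul_neg, ← sub_eq_add_neg] at e1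
    rw [sub_eq_zero] at k
    rw [← k] at e1
    exact sub_eq_zero.1 (aux_two _ e1)
  have c1 := cen (Complex.I • 1) (by simp [star_smul]) (by simp)
  have c4 := cen ((4 * Complex.I) • 1) (by simp [star_smul]) (by simp)
  have D : ∀ x, Φ 1 * x = x * Φ 1 := by
    intro x
    have e := H 1 1 (Complex.I • 1)
    have q : ((1 * 1 + 1 * star 1) * (Complex.I • 1) + (Complex.I • 1) * star (1 * 1 + 1 * star 1) : A)
        = (4 * Complex.I) • 1 := by
      simp only [star_one, mul_one, star_add, add_mul, mul_add, one_mul, ← add_smul]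
      congr 1; ring
    rw [q] at e
    simp only [star_one, mul_one, star_add, one_mul, h1, star_star] at e
    have e' : Φ ((4 * Complex.I) • 1) = (8 * Complex.I) • Φ 1 + (4 : ℂ) • Φ (Complex.I • 1) := by
      rw [e]
      simp only [mul_add, add_mul, one_mul, mul_one, smul_mul_assoc, mul_smul_comm]
      module
    have f := c4 x
    rw [e'] at f
    simp only [add_mul, mul_add, smul_mul_assoc, mul_smul_comm, c1 x, add_left_inj] at f
    have h8 : (8 * Complex.I) ≠ 0 := by simp
    exact smul_right_injective A h8 f
  have sa : ∀ x, star x = x → star (Φ x) = Φ x := by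
    intro x hx
    obtain ⟨y, hy⟩ : ∃ y : A, y = (4⁻¹ : ℂ) • x := ⟨_, rfl⟩
    have sy : star y = y := by rw [hy, star_smul, hx]; simp
    have e := H y 1 1
    have q : (y * 1 + 1 * star y) * 1 + 1 * star (y * 1 + 1 * star y) = x := by
      simp only [star_add, sy, mul_one, one_mul]
      rw [hy]
      module
    rw [q] at e
    rw [e]
    simp only [star_add, star_mul, star_star, sy, h1, star_one, mul_one, one_mul, D, mul_add, add_mul]
    abel
  have sk : ∀ x, star x = -x → star (Φ x) = -Φ x := by
    intro x hx
    have e := H x 1 1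
    simp only [star_add, star_mul, star_star, star_one, hx, h1, mul_one, one_mul, add_neg_cancel,
      star_zero, zero_mul, mul_zero, add_zero, Φ0, D, mul_neg, neg_mul, star_neg, neg_neg] at e
    have : Φ x + star (Φ x) = 0 := aux_two _ (by rw [e]; abel)
    rw [eq_neg_iff_add_eq_zero, add_comm, this]
  have odd : ∀ x, Φ (-x) = - Φ x := by
    have four : ∀ x, Φ ((4 : ℂ) • x) = (4 : ℂ) • Φ x + (8 : ℂ) • (x * Φ 1) := by
      intro x
      have e := H 1 1 x
      have q : ((1 * 1 + 1 * star 1) * x + x * star (1 * 1 + 1 * star 1) : A) = (4 : ℂ) • x := by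
        simp only [star_one, mul_one, star_add, add_mul, mul_add, one_mul]; module
      rw [q] at e
      rw [e]
      simp only [star_one, mul_one, star_add, add_mul, mul_add, one_mul, h1, D]
      module
    have sE := sa (-1) (by simp)
    have E : Φ (-1) = - Φ 1 := by
      have e := H (-1) (-1) 1
      have q : (((-1) * (-1) + (-1) * star (-1)) * 1 + 1 * star ((-1) * (-1) + (-1) * star (-1)) : A)
          = (4 : ℂ) • 1 := by
        simp only [star_one, star_neg, mul_one, star_add, one_mul, neg_mul, neg_neg, mul_neg]
        module
      rw [q, four] at e
      simp only [star_one, star_neg, mul_one, star_add, one_mul, neg_mul, neg_neg, mul_neg, sE,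
        add_mul, mul_add] at e
      have h8 : (8 : ℂ) ≠ 0 := by norm_num
      apply smul_right_injective A h8
      have : (8 : ℂ) • Φ (-1) = (8 : ℂ) • Φ (-1) + (((4 : ℂ) • Φ 1 + (8 : ℂ) • Φ 1) -
        ((4 : ℂ) • Φ 1 + (8 : ℂ) • Φ 1)) := by rw [sub_self, add_zero]
      nth_rw 1 [e] at this
      show (8 : ℂ) • Φ (-1) = (8 : ℂ) • (- Φ 1)
      rw [this]; module
    intro x
    have e := H (-1) 1 x
    have q : (((-1) * 1 + 1 * star (-1)) * x + x * star ((-1) * 1 + 1 * star (-1)) : A)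
        = (4 : ℂ) • (-x) := by
      simp only [star_one, star_neg, mul_one, star_add, add_mul, mul_add, one_mul, neg_mul, mul_neg]
      module
    rw [q, four, E] at e
    simp only [star_one, star_neg, mul_one, star_add, add_mul, mul_add, one_mul, neg_mul, mul_neg,
      h1, D] at e
    have h4 : (4 : ℂ) ≠ 0 := by norm_num
    apply smul_right_injective A h4
    show (4 : ℂ) • Φ (-x) = (4 : ℂ) • (- Φ x)
    rw [eq_sub_of_add_eq e]; module
  have main : ∀ c, star (Φ (star c)) - Φ c = 0 := by
    refine core4 hprime P sP pp P0 P1 (fun c => star (Φ (star c)) - Φ c) ?_ ?_ ?_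
    · intro x c
      obtain ⟨y, hy⟩ : ∃ y : A, y = (2⁻¹ : ℂ) • x := ⟨_, rfl⟩
      have q : 1 * y + y * star 1 = x := by
        simp only [star_one, one_mul, mul_one, hy]; module
      have e := H 1 y c
      have f := H 1 y (star c)
      rw [q] at e f
      have g : star (x * c + c * star x) = x * star c + star c * star x := by
        simp [add_comm]
      simp only [g, e, f]
      simp only [star_add, star_mul, star_star, mul_add, add_mul, mul_sub, sub_mul]
      abel
    · intro x hx
      simp only [hx, sa x hx, sub_self]
    · intro x hx
      have := sk (-x) (by rw [star_neg, hx])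
      have h3 := sk x hx
      have h4 := odd x
      simp only [hx, h4, star_neg, h3, neg_neg, sub_self]
  intro a
  have := sub_eq_zero.1 (main a)
  rw [← this, star_star]
end

section
/- Let 𝒜 be a unital prime ∗-algebra over ℂ with a nontrivial projection, and let Φ: 𝒜 → 𝒜 be a map satisfying Φ(A ⋄ B ⋄ C) = Φ(A) ⋄ B ⋄ C + A ⋄ Φ(B) ⋄ C + A ⋄ B ⋄ Φ(C) for all A, B, C ∈ 𝒜, such that Φ(1) and Φ(i·1) are self-adjoint. Then Φ(iA) = iΦ(A) for every A ∈ 𝒜. -/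
/-- A complementary pair of self-adjoint idempotents. -/
structure PPair {A : Type*} [Ring A] [StarRing A] (p q : A) : Prop where
  sp : star p = p
  sq : star q = q
  pp : p * p = p
  qq : q * q = q
  pq : p * q = 0
  qp : q * p = 0
  sum : p + q = 1
  p0 : p ≠ 0
  q0 : q ≠ 0

theorem PPair.symm {A : Type*} [Ring A] [StarRing A] {p q : A} (h : PPair p q) : PPair q p :=
  ⟨h.sq, h.sp, h.qq, h.pp, h.qp, h.pq, by rw [add_comm]; exact h.sum, h.q0, h.p0⟩

set_option linter.unusedSectionVars false
set_option linter.unusedSimpArgs false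
section aux
variable {A : Type*} [Ring A] [Algebra ℂ A] [StarRing A] [StarModule ℂ A]


theorem half_zero {x : A} (h : x + x = 0) : x = 0 := by
  have : (2:ℂ) • x = 0 := by rw [two_smul]; exact h
  exact (smul_eq_zero.mp this).resolve_left two_ne_zero

theorem I_inj {x : A} (h : (Complex.I : ℂ) • x = 0) : x = 0 :=
  (smul_eq_zero.mp h).resolve_left Complex.I_ne_zero

theorem starI (x : A) : star ((Complex.I : ℂ) • x) = -((Complex.I : ℂ) • star x) := by
  simp [star_smul]

theorem II (x : A) : (Complex.I : ℂ) • ((Complex.I : ℂ) • x) = -x := by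
  rw [smul_smul]; simp

theorem sJ_add (c x y : A) : sJordan c (x + y) = sJordan c x + sJordan c y := by
  simp only [sJordan, mul_add, add_mul]; abel

theorem sJ_sub (c x y : A) : sJordan c (x - y) = sJordan c x - sJordan c y := by
  simp only [sJordan, mul_sub, sub_mul]; abel

theorem sJ_I (c x : A) : sJordan c ((Complex.I : ℂ) • x) = (Complex.I : ℂ) • sJordan c x := by
  simp only [sJordan, mul_smul_comm, smul_mul_assoc, smul_add]

theorem sJ_Il (c x : A) : sJordan ((Complex.I : ℂ) • c) x = (Complex.I : ℂ) • (c * x - x * star c) := by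
  simp only [sJordan, starI, mul_smul_comm, smul_mul_assoc, smul_add, smul_neg, mul_neg, sub_eq_add_neg]

/-- splitting a sum and a difference -/
theorem split_zero {x y : A} (h : x + y = 0) (h' : x - y = 0) : x = 0 ∧ y = 0 := by
  have h1 : x = y := sub_eq_zero.mp h'
  subst h1
  exact ⟨half_zero h, half_zero h⟩

/-- Reduction to a derivation for the binary product. -/
theorem binary (Φ : A → A)
    (hΦ : ∀ a b c : A, Φ (sJordanTriple a b c) =
      sJordanTriple (Φ a) b c + sJordanTriple a (Φ b) c + sJordanTriple a b (Φ c))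
    (h1 : star (Φ 1) = Φ 1) (hi : star (Φ ((Complex.I : ℂ) • (1 : A))) = Φ ((Complex.I : ℂ) • (1 : A))) :
    Φ 0 = 0 ∧ Φ ((Complex.I : ℂ) • (1 : A)) = 0 ∧ (∀ c, Φ 1 * c = c * Φ 1) ∧
    (∀ x, Φ (x + x) = (Φ 1 * x + Φ 1 * x) + (Φ x + Φ x)) ∧
    (∀ c d, Φ (sJordan c d) = sJordan (Φ c) d + sJordan c (Φ d)) := by
  have h0 : Φ 0 = 0 := by simpa [sJordanTriple, sJordan] using hΦ 0 0 0
  have hv : Φ ((Complex.I : ℂ) • (1 : A)) = 0 := by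
    have := hΦ ((Complex.I : ℂ) • (1 : A)) 1 1
    simp [sJordanTriple, sJordan, h0, h1, hi, starI] at this
    exact half_zero (half_zero this.symm)
  have hc : ∀ c, Φ 1 * c = c * Φ 1 := by
    intro c
    have := hΦ 1 ((Complex.I : ℂ) • (1 : A)) c
    simp only [sJordanTriple, sJordan, star_one, one_mul, mul_one, hv, h1, add_mul, mul_add,
      star_add, starI, star_mul, smul_mul_assoc, mul_smul_comm, star_zero, zero_mul, mul_zero,
      mul_neg, add_zero] at this
    have e0 : (Complex.I : ℂ) • c + (Complex.I : ℂ) • c + (-((Complex.I : ℂ) • c) + -((Complex.I : ℂ) • c)) = 0 := by abel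
    rw [e0, h0] at this
    have e2 : (Complex.I : ℂ) • (Φ 1 * c - c * Φ 1) + (Complex.I : ℂ) • (Φ 1 * c - c * Φ 1) = 0 := by
      rw [smul_sub]
      refine Eq.trans ?_ this.symm
      abel
    exact sub_eq_zero.mp (I_inj (half_zero e2))
  have hh : ∃ b : A, b + b = 1 ∧ star b = b ∧ ∀ x, b * x = x * b := by
    refine ⟨(2⁻¹ : ℂ) • 1, ?_, ?_, ?_⟩
    · rw [← add_smul]; norm_num
    · simp [star_smul]
    · intro x; simp
  obtain ⟨b, hb, sb, cb⟩ := hh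
  have T1 : ∀ x y : A, sJordan (sJordan 1 x) y = sJordan x y + sJordan x y := by
    intro x y; simp [sJordan, add_mul, mul_add]; abel
  have b1 : sJordan 1 b = 1 := by simp [sJordan, hb]
  have ub : sJordan (Φ 1) b = Φ 1 := by
    simp only [sJordan, h1, ← cb, ← add_mul, hb, one_mul]
  have s1 : ∀ x : A, sJordan 1 x = x + x := by intro x; simp [sJordan]
  have hbz : Φ b = 0 := by
    have := hΦ 1 b b
    simp only [sJordanTriple, b1, ub, T1] at this
    simp only [sJordan, ← cb, ← add_mul, hb, one_mul, star_one, mul_one, h1, star_add,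
      ← mul_add] at this
    have e1 : (Φ b + star (Φ b)) + (Φ b + Φ b) = 0 := by
      have h3 : b * (Φ b + star (Φ b)) + b * (Φ b + star (Φ b)) = Φ b + star (Φ b) := by
        rw [← add_mul, hb, one_mul]
      have h4 : Φ 1 = Φ 1 + ((Φ b + star (Φ b)) + (Φ b + Φ b)) := by
        refine this.trans ?_
        try rw [← h3]
        try simp only [mul_add, add_mul]
        try abel
      exact (left_eq_add.mp h4)
    have e2 := congrArg star e1
    simp only [star_add, star_star, star_zero] at e2
    have e3 : (Φ b - star (Φ b)) + (Φ b - star (Φ b)) = 0 := by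
      have : (Φ b - star (Φ b)) + (Φ b - star (Φ b)) = ((Φ b + star (Φ b)) + (Φ b + Φ b)) - (star (Φ b) + Φ b + (star (Φ b) + star (Φ b))) := by abel
      rw [this, e1, e2, sub_zero]
    have e4 := sub_eq_zero.mp (half_zero e3)
    rw [← e4] at e1
    exact half_zero (half_zero e1)
  have hdbl : ∀ x, Φ (x + x) = (Φ 1 * x + Φ 1 * x) + (Φ x + Φ x) := by
    intro x
    have := hΦ 1 b x
    simp only [sJordanTriple, b1, ub, hbz, s1] at this
    rw [this]
    simp [sJordan, h1, ← hc]
  refine ⟨h0, hv, hc, hdbl, ?_⟩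
  intro c d
  have := hΦ 1 c d
  simp only [sJordanTriple, T1, hdbl] at this
  have e : sJordan (sJordan (Φ 1) c) d = Φ 1 * sJordan c d + Φ 1 * sJordan c d := by
    simp only [sJordan, h1, ← hc, star_add, star_mul, mul_add, add_mul, mul_assoc]
    have : ∀ z, d * (Φ 1 * z) = Φ 1 * (d * z) := by
      intro z; rw [← mul_assoc, ← hc, mul_assoc]
    simp only [this, hc (star c)]
    simp only [← hc, this]
    abel
  rw [e] at this
  have key : (Φ (sJordan c d) - (sJordan (Φ c) d + sJordan c (Φ d))) +
      (Φ (sJordan c d) - (sJordan (Φ c) d + sJordan c (Φ d))) = 0 := by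
    have h5 := sub_eq_zero.mpr this
    rw [← h5]
    abel
  exact sub_eq_zero.mp (half_zero key)

/-- Consequences: vanishing properties of the map `E`. -/
theorem E_props (Φ : A → A) (h1 : star (Φ 1) = Φ 1) (hv : Φ ((Complex.I : ℂ) • (1 : A)) = 0)
    (hc : ∀ c, Φ 1 * c = c * Φ 1)
    (hdbl : ∀ x, Φ (x + x) = (Φ 1 * x + Φ 1 * x) + (Φ x + Φ x))
    (hD : ∀ c d, Φ (sJordan c d) = sJordan (Φ c) d + sJordan c (Φ d)) :
    (∀ x, Φ (-x) = - Φ x) ∧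
    (∀ h, star h = h → Φ ((Complex.I : ℂ) • h) = (Complex.I : ℂ) • Φ h - (Complex.I : ℂ) • (Φ 1 * h)) := by
  have hsa : ∀ h, star h = h → star (Φ h) = Φ h := by
    intro h hh
    have := hD h 1
    simp only [sJordan, hh, mul_one, one_mul, hdbl] at this
    rw [← hc h] at this
    have e : Φ h - star (Φ h) = 0 := by
      have h5 := sub_eq_zero.mpr this
      rw [← h5]; abel
    exact (sub_eq_zero.mp e).symm
  have hw : Φ (-1) = - Φ 1 := by
    have := hD (-1) (-1)
    have s : star (Φ (-1)) = Φ (-1) := hsa _ (by simp)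
    simp only [sJordan, star_neg, star_one, s, mul_neg, neg_mul, mul_one, one_mul, neg_neg,
      hdbl] at this
    have e : (Φ (-1) + Φ 1) + (Φ (-1) + Φ 1) + ((Φ (-1) + Φ 1) + (Φ (-1) + Φ 1)) = 0 := by
      have h5 := sub_eq_zero.mpr this
      rw [← h5]; abel
    exact eq_neg_of_add_eq_zero_left (half_zero (half_zero e))
  constructor
  · intro x
    have := hD (-1) x
    simp only [sJordan, star_neg, star_one, hw, h1, mul_neg, neg_mul, mul_one, one_mul,
      ← hc x] at this
    rw [hdbl] at this
    have e : (Φ (-x) + Φ x) + (Φ (-x) + Φ x) = 0 := by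
      have h5 := sub_eq_zero.mpr this
      rw [← h5]; simp only [mul_neg]; abel
    exact eq_neg_of_add_eq_zero_left (half_zero e)
  · intro h hh
    have := hD h ((Complex.I : ℂ) • 1)
    rw [hv] at this
    simp only [sJordan, hh, hsa h hh, mul_smul_comm, smul_mul_assoc, mul_one, one_mul, mul_zero,
      zero_mul, hdbl] at this
    have e : (Φ ((Complex.I : ℂ) • h) - ((Complex.I : ℂ) • Φ h - (Complex.I : ℂ) • (Φ 1 * h))) + (Φ ((Complex.I : ℂ) • h) - ((Complex.I : ℂ) • Φ h - (Complex.I : ℂ) • (Φ 1 * h))) = 0 := by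
      have h5 := sub_eq_zero.mpr this
      rw [← h5]; abel
    exact sub_eq_zero.mp (half_zero e)

/-- Vanishing on off-diagonal corners. -/
theorem E12 (hprime : ∀ a b : A, (∀ x : A, a * x * b = 0) → a = 0 ∨ b = 0)
    (E : A → A) (hE : ∀ c d, E (sJordan c d) = sJordan c (E d))
    (hEI : ∀ d, E ((Complex.I : ℂ) • d) = -((Complex.I : ℂ) • E d)) (hEs : ∀ h, star h = h → E h = 0)
    {p q : A} (hp : PPair p q) (d : A) (pd : p * d = d) (dq : d * q = d) : E d = 0 := by
  have dp : d * p = 0 := by rw [← dq, mul_assoc, hp.qp, mul_zero]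
  have qd : q * d = 0 := by rw [← pd, ← mul_assoc, hp.qp, zero_mul]
  have a1 : E d = p * E d + E d * p := by
    have := hE p d
    simpa [sJordan, hp.sp, pd, dp] using this
  have a2 : -(E d) = p * E d - E d * p := by
    have := hE ((Complex.I : ℂ) • p) d
    rw [sJ_Il, sJ_Il, hp.sp, pd, dp, sub_zero, hEI, ← smul_neg] at this
    have := sub_eq_zero.mpr this
    rw [← smul_sub] at this
    exact sub_eq_zero.mp (I_inj this)
  have pe : p * E d = 0 := by
    apply half_zero
    have : p * E d + p * E d = (p * E d + E d * p) + (p * E d - E d * p) := by abel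
    rw [this, ← a1, ← a2, add_neg_cancel]
  have qe : q * E d = E d := by
    have : (p + q) * E d = E d := by rw [hp.sum, one_mul]
    rwa [add_mul, pe, zero_add] at this
  have ep : E d * p = E d := by rw [pe, zero_add] at a1; exact a1.symm
  have eq0 : E d * q = 0 := by rw [← ep, mul_assoc, hp.pq, mul_zero]
  have hk : ∀ k, star k = k → d * k * E d = 0 := by
    intro k hk
    have h2 := hE (d * (q * k * q)) d
    have sc : star (d * (q * k * q)) = q * k * q * star d := by
      simp only [star_mul, hp.sq, hk, mul_assoc]
    have z1 : d * (q * k * q) * d = 0 := by rw [mul_assoc, mul_assoc (q * k), qd]; simp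
    have z2 : E d * (q * k * q * star d) = 0 := by
      rw [← mul_assoc, ← mul_assoc, ← mul_assoc, eq0]; simp
    have z3 : d * (q * k * q) * E d = d * k * E d := by
      rw [mul_assoc, mul_assoc (q * k), qe, ← mul_assoc, ← mul_assoc, dq]
    simp only [sJordan, sc, z1, z2, z3, zero_add, add_zero] at h2
    rw [← h2]
    apply hEs
    simp only [star_mul, hp.sq, hk, mul_assoc, star_star]
  have hall : ∀ x, d * x * E d = 0 := by
    intro x
    have g1 := hk (x + star x) (by rw [star_add, star_star, add_comm])
    have g2 := hk ((Complex.I : ℂ) • (x - star x)) (by rw [starI, star_sub, star_star, ← smul_neg, neg_sub])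
    rw [mul_smul_comm, smul_mul_assoc] at g2
    have g2 := I_inj g2
    rw [mul_add, add_mul] at g1
    rw [mul_sub, sub_mul] at g2
    exact (split_zero g1 g2).1
  rcases hprime _ _ hall with h | h
  · rw [h]; exact hEs 0 (star_zero A)
  · exact h

/-- `Φ(ic) = iΦ(c)` on diagonal corners. -/
theorem F11 (hprime : ∀ a b : A, (∀ x : A, a * x * b = 0) → a = 0 ∨ b = 0)
    (Φ : A → A) (h0 : Φ 0 = 0)
    (hD : ∀ c d, Φ (sJordan c d) = sJordan (Φ c) d + sJordan c (Φ d))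
    (hc : ∀ c, Φ 1 * c = c * Φ 1)
    {p q : A} (hp : PPair p q)
    (h12 : ∀ d, p * d = d → d * q = d → Φ ((Complex.I : ℂ) • d) = (Complex.I : ℂ) • Φ d - (Complex.I : ℂ) • (Φ 1 * star d))
    (c : A) (pc : p * c = c) (cp : c * p = c) : Φ ((Complex.I : ℂ) • c) = (Complex.I : ℂ) • Φ c := by
  have hF : ∀ a b, Φ ((Complex.I : ℂ) • sJordan a b) - (Complex.I : ℂ) • Φ (sJordan a b) =
      sJordan a (Φ ((Complex.I : ℂ) • b) - (Complex.I : ℂ) • Φ b) := by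
    intro a b
    rw [← sJ_I, hD, hD, sJ_sub, sJ_I, sJ_I, smul_add]; abel
  have cq : c * q = 0 := by rw [← cp, mul_assoc, hp.pq, mul_zero]
  have qc : q * c = 0 := by rw [← pc, ← mul_assoc, hp.qp, zero_mul]
  have scq : star c * q = 0 := by
    have := congrArg star qc; simpa [hp.sq] using this
  have qstar : ∀ x y : A, q * (sJordan q x) * q = q * x * q + q * x * q := by
    intro x _
    simp only [sJordan, hp.sq, mul_add, add_mul]
    rw [← mul_assoc, hp.qq, mul_assoc q (x * q) q, mul_assoc x q q, hp.qq, ← mul_assoc]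
  have q22 : ∀ z : A, sJordan q z = 0 → z = p * z * p := by
    intro z hz
    have h3 : q * z * q = 0 := half_zero (by rw [← qstar z z, hz]; simp)
    simp only [sJordan, hp.sq] at hz
    have h4 : q * z = 0 := by
      have := congrArg (q * ·) hz
      simp only [mul_add, ← mul_assoc, hp.qq, h3, mul_zero, add_zero] at this
      exact this
    have h5 : z * q = 0 := by rwa [h4, zero_add] at hz
    have h6 : (p + q) * z * (p + q) = z := by rw [hp.sum]; simp
    rw [add_mul, h4, add_zero, mul_add, mul_assoc p z q, h5, mul_zero, add_zero] at h6
    exact h6.symm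
  have qc0 : sJordan q c = 0 := by simp [sJordan, hp.sq, qc, cq]
  have n22 : q * Φ c * q = 0 := by
    have := hD q c
    rw [qc0, h0] at this
    have := congrArg (fun z => q * z * q) this
    simp only [mul_add, add_mul, qstar _ c] at this
    have e1 : q * sJordan (Φ q) c * q = 0 := by
      simp only [sJordan, mul_add, add_mul]
      rw [← mul_assoc q c, qc, mul_assoc q, mul_assoc (Φ q), cq]; simp
    rw [e1] at this
    simp only [mul_zero, zero_mul, zero_add] at this
    exact half_zero this.symm
  have sn22 : q * star (Φ c) * q = 0 := by
    have := congrArg star n22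
    simpa [hp.sq, mul_assoc] using this
  have m22 : q * Φ ((Complex.I : ℂ) • c) * q = 0 := by
    have hz : sJordan q (Φ ((Complex.I : ℂ) • c) - (Complex.I : ℂ) • Φ c) = 0 := by rw [← hF, qc0]; simp [h0]
    have := congrArg (fun z => q * z * q) (q22 _ hz)
    simp only [mul_sub, sub_mul, mul_smul_comm, smul_mul_assoc, n22] at this
    simp only [← mul_assoc, hp.qp, zero_mul, sub_zero, smul_zero] at this
    simpa using this
  have sm22 : q * star (Φ ((Complex.I : ℂ) • c)) * q = 0 := by
    have := congrArg star m22
    simpa [hp.sq, mul_assoc] using this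
  have hz : sJordan q (Φ ((Complex.I : ℂ) • c) - (Complex.I : ℂ) • Φ c) = 0 := by rw [← hF, qc0]; simp [h0]
  have hzz := q22 _ hz
  have main : ∀ x, p * (Φ ((Complex.I : ℂ) • c) - (Complex.I : ℂ) • Φ c) * p * x * q = 0 := by
    intro x
    -- general formula for the corner of `Φ (a d)`
    obtain ⟨d, hd⟩ : ∃ d, d = p * x * q := ⟨_, rfl⟩
    have pd : p * d = d := by rw [hd, ← mul_assoc, ← mul_assoc, hp.pp]
    have dq : d * q = d := by rw [hd, mul_assoc, hp.qq]
    have gen : ∀ a, a * p = a → star a * q = 0 → d * star a = 0 → q * star (Φ a) * q = 0 →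
        p * Φ (a * d) * q = p * Φ a * d + p * a * Φ d * q := by
      intro a _ ha2 ha3 ha4
      have := hD a d
      have e : sJordan a d = a * d := by simp [sJordan, ha3]
      rw [e] at this
      rw [this]
      simp only [sJordan, mul_add, add_mul]
      have t1 : p * (Φ a * d) * q = p * Φ a * d := by
        rw [← mul_assoc, mul_assoc _ d q, dq]
      have t2 : p * (d * star (Φ a)) * q = 0 := by
        have : d * q * star (Φ a) * q = 0 := by
          rw [mul_assoc d, mul_assoc d, ha4, mul_zero]
        rw [← mul_assoc, pd]
        rwa [dq] at this
      have t3 : p * (Φ d * star a) * q = 0 := by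
        rw [mul_assoc, mul_assoc, ha2]; simp
      rw [t1, t2, t3, ← mul_assoc]; simp
    have dsc : d * star c = 0 := by
      have : q * star c = 0 := by
        have := congrArg star cq; simpa [hp.sq] using this
      rw [← dq, mul_assoc, this, mul_zero]
    have g1 := gen c cp scq dsc sn22
    have g2 := gen ((Complex.I : ℂ) • c) (by rw [smul_mul_assoc, cp])
      (by rw [starI, neg_mul, smul_mul_assoc, scq]; simp)
      (by rw [starI, mul_neg, mul_smul_comm, dsc]; simp) sm22
    have g3 := h12 (c * d) (by rw [← mul_assoc, pc]) (by rw [mul_assoc, dq])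
    have g4 : p * (Φ 1 * star (c * d)) * q = 0 := by
      rw [hc, star_mul, mul_assoc, mul_assoc, hc]
      have : star c * (q * Φ 1) = 0 := by rw [← mul_assoc, scq, zero_mul]
      rw [mul_assoc (star d), this]; simp
    rw [smul_mul_assoc, g3, mul_sub, sub_mul, mul_smul_comm, smul_mul_assoc, mul_smul_comm,
      smul_mul_assoc, g4, g1] at g2
    have g5 : p * (Φ ((Complex.I : ℂ) • c) - (Complex.I : ℂ) • Φ c) * d = 0 := by
      have h5 := sub_eq_zero.mpr g2.symm
      rw [← h5]
      simp only [mul_sub, sub_mul, mul_smul_comm, smul_mul_assoc, smul_add, smul_zero]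
      abel
    rw [hd] at g5
    simpa only [mul_assoc] using g5
  rcases hprime _ _ main with h | h
  · rw [h] at hzz
    exact sub_eq_zero.mp hzz
  · exact absurd h hp.q0

/-- Vanishing on everything. -/
theorem Eall (hprime : ∀ a b : A, (∀ x : A, a * x * b = 0) → a = 0 ∨ b = 0)
    (E : A → A) (hE : ∀ c d, E (sJordan c d) = sJordan c (E d))
    {p q : A} (hp : PPair p q)
    (h11 : ∀ d, p * d = d → d * p = d → E d = 0)
    (h22 : ∀ d, q * d = d → d * q = d → E d = 0) (d : A) : E d = 0 := by
  have half : ∀ {p q : A} (_ : PPair p q) (_ : ∀ d, q * d = d → d * q = d → E d = 0)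
      (d : A), p * d * p = 0 → q * d * q = 0 → p * E d = 0 := by
    intro p q hp h22 d dp dq
    have key : ∀ x, q * x * (p * E d) = 0 := by
      intro x
      have inn : ∀ x, E (sJordan (q * x * p) d) = 0 := by
        intro x
        have hpd : p * d = p * d * q := by
          have : p * d * (p + q) = p * d := by rw [hp.sum, mul_one]
          rw [mul_add, dp, zero_add] at this; exact this.symm
        have hdp : d * p = q * (d * p) := by
          have : (p + q) * (d * p) = d * p := by rw [hp.sum, one_mul]
          rw [add_mul, ← mul_assoc p, dp, zero_add] at this; exact this.symm
        have e : sJordan (q * x * p) d = q * (x * (p * d) + d * p * star x) * q := by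
          simp only [sJordan, star_mul, hp.sp, hp.sq]
          rw [mul_add, add_mul]
          congr 1
          · rw [mul_assoc, hpd]; simp only [mul_assoc, hp.qq]
          · rw [← mul_assoc q, ← hdp]; simp only [mul_assoc]
        rw [e]
        apply h22
        · simp only [← mul_assoc, hp.qq]
        · rw [mul_assoc, hp.qq]
      have i1 := inn x
      have i2 := inn ((Complex.I : ℂ) • x)
      have e2 : q * ((Complex.I : ℂ) • x) * p = (Complex.I : ℂ) • (q * x * p) := by
        rw [mul_smul_comm, smul_mul_assoc]
      rw [e2, hE, sJ_Il] at i2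
      rw [hE] at i1
      have := (split_zero i1 (I_inj i2)).1
      rwa [mul_assoc] at this
    exact (hprime _ _ key).resolve_left hp.q0
  have off : ∀ d, p * d * p = 0 → q * d * q = 0 → E d = 0 := by
    intro d a b
    have g1 := half hp h22 d a b
    have g2 := half hp.symm h11 d b a
    have : (p + q) * E d = E d := by rw [hp.sum, one_mul]
    rw [← this, add_mul, g1, g2, add_zero]
  have diag : ∀ {p q : A} (_ : PPair p q)
      (_ : ∀ d, p * d * p = 0 → q * d * q = 0 → E d = 0) (d : A), p * E d * p = 0 := by
    intro p q hp off d
    have key : ∀ x, q * x * (p * E d * p) = 0 := by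
      intro x
      have inn : ∀ x, sJordan p (sJordan (q * x * p) (E d)) = 0 := by
        intro x
        rw [← hE, ← hE]
        have y0 : p * sJordan (q * x * p) d * p = 0 := by
          simp only [sJordan, star_mul, hp.sp, hp.sq, mul_add, add_mul]
          simp only [← mul_assoc, hp.pq, zero_mul, zero_add]
          simp only [mul_assoc, hp.qp, mul_zero]
        generalize sJordan (q * x * p) d = y at y0
        apply off
        · simp only [sJordan, hp.sp, mul_add, add_mul]
          simp only [← mul_assoc, hp.pp]
          rw [mul_assoc (p * y) p p, hp.pp, y0, add_zero]
        · simp only [sJordan, hp.sp, mul_add, add_mul]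
          simp only [← mul_assoc, hp.qp, zero_mul, zero_add]
          simp only [mul_assoc, hp.pq, mul_zero]
      have form : ∀ c, p * c = 0 → c * p = c → sJordan p (sJordan c (E d)) =
          c * E d * p + p * E d * star c := by
        intro c hc1 _
        have hs : star c * p = 0 := by
          have := congrArg star hc1; simpa [hp.sp] using this
        simp only [sJordan, hp.sp, mul_add, add_mul]
        rw [← mul_assoc p c, hc1, mul_assoc (E d), hs]
        simp [mul_assoc, add_comm]
      have hc1 : p * (q * x * p) = 0 := by simp only [← mul_assoc, hp.pq, zero_mul]
      have hc2 : (q * x * p) * p = q * x * p := by rw [mul_assoc, hp.pp]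
      have i1 := inn x
      have i2 := inn ((Complex.I : ℂ) • x)
      have e2 : q * ((Complex.I : ℂ) • x) * p = (Complex.I : ℂ) • (q * x * p) := by
        rw [mul_smul_comm, smul_mul_assoc]
      rw [form _ hc1 hc2] at i1
      rw [e2, form _ (by rw [mul_smul_comm, hc1, smul_zero]) (by rw [smul_mul_assoc, hc2]),
        starI, mul_neg, mul_smul_comm, smul_mul_assoc, smul_mul_assoc, ← sub_eq_add_neg,
        ← smul_sub] at i2
      have := (split_zero i1 (I_inj i2)).1
      simpa only [mul_assoc] using this
    exact (hprime _ _ key).resolve_left hp.q0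
  have d1 := diag hp off d
  have d2 := diag hp.symm (fun d a b => off d b a) d
  have ex : ∀ x, sJordan q (sJordan p x) = q * x * p + p * x * q := by
    intro x
    simp only [sJordan, hp.sp, hp.sq, mul_add, add_mul]
    rw [← mul_assoc q p x, hp.qp, mul_assoc x p q, hp.pq]; simp [mul_assoc]
  have o : q * E d * p + p * E d * q = 0 := by
    rw [← ex, ← hE, ← hE, ex]
    apply off
    · simp only [mul_add, add_mul]
      simp only [← mul_assoc, hp.pq, zero_mul, zero_add]
      simp only [mul_assoc, hp.qp, mul_zero]
    · simp only [mul_add, add_mul]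
      simp only [← mul_assoc, hp.qp, zero_mul, add_zero]
      simp only [mul_assoc, hp.pq, mul_zero]
  have t : (p + q) * E d * (p + q) = E d := by rw [hp.sum]; simp
  have t2 : (p + q) * E d * (p + q) = p * E d * p + q * E d * q +
      (q * E d * p + p * E d * q) := by
    simp only [mul_add, add_mul]; abel
  rw [← t, t2, d1, d2, o]; simp

end aux

theorem stmt11 {A : Type*} [Ring A] [Algebra ℂ A] [StarRing A] [StarModule ℂ A]
    (hprime : ∀ a b : A, (∀ x : A, a * x * b = 0) → a = 0 ∨ b = 0)
    (hproj : ∃ P : A, star P = P ∧ P * P = P ∧ P ≠ 0 ∧ P ≠ 1)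
    (Φ : A → A)
    (hΦ : ∀ a b c : A, Φ (sJordanTriple a b c) =
      sJordanTriple (Φ a) b c + sJordanTriple a (Φ b) c + sJordanTriple a b (Φ c))
    (h1 : star (Φ 1) = Φ 1) (hi : star (Φ ((Complex.I : ℂ) • (1 : A))) = Φ ((Complex.I : ℂ) • (1 : A))) :
    ∀ a : A, Φ ((Complex.I : ℂ) • a) = (Complex.I : ℂ) • Φ a := by
  obtain ⟨h0, hv, hc, hdbl, hD⟩ := binary Φ hΦ h1 hi
  obtain ⟨hodd, hI⟩ := E_props Φ h1 hv hc hdbl hD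
  obtain ⟨p, sp, pp, p0, p1⟩ := hproj
  have hp : PPair p (1 - p) :=
    ⟨sp, by rw [star_sub, star_one, sp], pp, by simp [mul_sub, sub_mul, pp],
      by simp [mul_sub, pp], by simp [sub_mul, pp], by abel, p0,
      fun h => p1 (sub_eq_zero.mp h).symm⟩
  let E : A → A := fun d => Φ ((Complex.I : ℂ) • d) - (Complex.I : ℂ) • Φ d
    + (Complex.I : ℂ) • (Φ 1 * star d)
  have hE : ∀ c d, E (sJordan c d) = sJordan c (E d) := by
    intro c d
    have e : Φ 1 * star (sJordan c d) = sJordan c (Φ 1 * star d) := by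
      simp only [sJordan, star_add, star_mul, star_star, mul_add, ← mul_assoc, hc c]
      abel
    simp only [E]
    rw [e, ← sJ_I, hD, hD, sJ_add, sJ_sub, sJ_I, sJ_I, sJ_I, smul_add]
    abel
  have hEI : ∀ d, E ((Complex.I : ℂ) • d) = -((Complex.I : ℂ) • E d) := by
    intro d
    simp only [E]
    rw [II, hodd, starI, mul_neg, mul_smul_comm, smul_neg, II, smul_add, smul_sub, II, II]
    abel
  have hEs : ∀ h, star h = h → E h = 0 := by
    intro h hh
    simp only [E]
    rw [hI h hh, hh]
    abel
  have h12 : ∀ {p q : A} (_ : PPair p q) (d : A), p * d = d → d * q = d →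
      Φ ((Complex.I : ℂ) • d) = (Complex.I : ℂ) • Φ d - (Complex.I : ℂ) • (Φ 1 * star d) := by
    intro p q hp d a b
    have := E12 hprime E hE hEI hEs hp d a b
    simp only [E] at this
    rw [← sub_eq_zero, ← this]
    abel
  have f11 := fun c a b => F11 hprime Φ h0 hD hc hp (h12 hp) c a b
  have f22 := fun c a b => F11 hprime Φ h0 hD hc hp.symm (h12 hp.symm) c a b
  let F : A → A := fun d => Φ ((Complex.I : ℂ) • d) - (Complex.I : ℂ) • Φ d
  have hF : ∀ c d, F (sJordan c d) = sJordan c (F d) := by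
    intro c d
    simp only [F]
    rw [← sJ_I, hD, hD, sJ_sub, sJ_I, sJ_I, smul_add]
    abel
  intro a
  exact sub_eq_zero.mp (Eall hprime F hF hp (fun d a b => sub_eq_zero.mpr (f11 d a b))
    (fun d a b => sub_eq_zero.mpr (f22 d a b)) a)
end
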